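/- Let n ≥ 2, let p_1, …, p_n be points in the Euclidean plane, and let B ≥ 0 be a real number. There exists a pyramidal tour of p_1, …, p_n whose bottleneck is at most B if and only if there exists k with 1 ≤ k < n such that there is an (n,k)-partial tour with bottleneck at most B and dist(p_k, p_n) ≤ B. -/

import Mathlib

noncomputable section

/-- Points in the Euclidean plane. -/
abbrev Pt := EuclideanSpace ℝ (Fin 2)

/-- The pairs `(x, x')` of elements of `X` with `x < x'` that are consecutive in `X`,
i.e. no element of `X` lies strictly between them. -/
def consecPairs (X : Finset ℕ) : Finset (ℕ × ℕ) :=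
  (X ×ˢ X).filter fun q => q.1 < q.2 ∧ ∀ y ∈ X, ¬ (q.1 < y ∧ y < q.2)

/-- The chain bottleneck of `X`: the maximum distance between consecutive elements of `X`
(`0` if `X` has at most one element). -/
def chainBot (p : ℕ → Pt) (X : Finset ℕ) : ℝ :=
  (consecPairs X).fold max 0 fun q => dist (p q.1) (p q.2)

/-- `(S, T)` is an `(i,j)`-partial tour: `S ∪ T = {1,…,i}`, `S ∩ T = {1}`,
`max S = i` and `max T = j`. -/
def IsPartialTour (i j : ℕ) (S T : Finset ℕ) : Prop :=
  S ∪ T = Finset.Icc 1 i ∧ S ∩ T = {1} ∧ S.max = (i : WithBot ℕ) ∧ T.max = (j : WithBot ℕ)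

/-- `(S, T)` is a pyramidal tour of `p₁,…,pₙ`: `S ∪ T = {1,…,n}` and `S ∩ T = {1, n}`. -/
def IsPyramidal (n : ℕ) (S T : Finset ℕ) : Prop :=
  S ∪ T = Finset.Icc 1 n ∧ S ∩ T = {1, n}

theorem chainBot_le_iff (p : ℕ → Pt) (X : Finset ℕ) (B : ℝ) (hB : 0 ≤ B) :
    chainBot p X ≤ B ↔ ∀ a ∈ X, ∀ b ∈ X, a < b → (∀ y ∈ X, ¬ (a < y ∧ y < b)) →
      dist (p a) (p b) ≤ B := by
  unfold chainBot consecPairs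
  rw [Finset.fold_max_le]
  simp only [Finset.mem_filter, Finset.mem_product, Prod.forall]
  constructor
  · rintro ⟨_, h⟩ a ha b hb hab hy
    exact h a b ⟨⟨ha, hb⟩, hab, hy⟩
  · intro h
    exact ⟨hB, fun a b ⟨⟨ha, hb⟩, hab, hy⟩ => h a ha b hb hab hy⟩

theorem max_eq_coe_iff (X : Finset ℕ) (m : ℕ) :
    X.max = (m : WithBot ℕ) ↔ m ∈ X ∧ ∀ y ∈ X, y ≤ m := by
  constructor
  · intro h
    exact ⟨Finset.mem_of_max h, fun y hy => Finset.le_max_of_eq hy h⟩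
  · rintro ⟨h1, h2⟩
    apply le_antisymm
    · exact Finset.max_le fun y hy => WithBot.coe_le_coe.2 (h2 y hy)
    · exact Finset.le_max h1

theorem stmt_3 (n : ℕ) (hn : 2 ≤ n) (p : ℕ → Pt) (B : ℝ) (hB : 0 ≤ B) :
    (∃ S T : Finset ℕ, IsPyramidal n S T ∧ max (chainBot p S) (chainBot p T) ≤ B) ↔
      ∃ k, 1 ≤ k ∧ k < n ∧
        (∃ S T : Finset ℕ, IsPartialTour n k S T ∧ max (chainBot p S) (chainBot p T) ≤ B) ∧
        dist (p k) (p n) ≤ B := by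
  simp only [max_le_iff, chainBot_le_iff p _ B hB, IsPyramidal, IsPartialTour, max_eq_coe_iff,
    Finset.ext_iff, Finset.mem_union, Finset.mem_inter, Finset.mem_Icc, Finset.mem_insert,
    Finset.mem_singleton]
  constructor
  · rintro ⟨S, T, ⟨hU, hI⟩, hS, hT⟩
    have h1 : 1 ∈ S ∧ 1 ∈ T := (hI 1).2 (Or.inl rfl)
    have h2 : n ∈ S ∧ n ∈ T := (hI n).2 (Or.inr rfl)
    have hne : (T.erase n).Nonempty := ⟨1, Finset.mem_erase.2 ⟨by omega, h1.2⟩⟩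
    obtain ⟨k, hk, hmax⟩ : ∃ k ∈ T.erase n, ∀ y ∈ T.erase n, y ≤ k :=
      ⟨_, Finset.max'_mem _ hne, fun y hy => Finset.le_max' _ y hy⟩
    simp only [Finset.mem_erase] at hk hmax
    have hTn : ∀ y ∈ T, 1 ≤ y ∧ y ≤ n := fun y hy => (hU y).1 (Or.inr hy)
    have hSn : ∀ y ∈ S, 1 ≤ y ∧ y ≤ n := fun y hy => (hU y).1 (Or.inl hy)
    have hkn := hTn k hk.2
    refine ⟨k, hkn.1, by omega, ⟨S, T.erase n, ⟨?_, ?_, ⟨h2.1, fun y hy => (hSn y hy).2⟩, ?_⟩,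
      hS, ?_⟩, ?_⟩
    · intro a
      rw [← hU a, Finset.mem_erase]
      by_cases h : a = n
      · subst h; simp [h2.1]
      · simp [h]
    · intro a
      have := hI a
      rw [Finset.mem_erase]
      constructor
      · rintro ⟨ha, hb, hc⟩
        exact (this.1 ⟨ha, hc⟩).resolve_right hb
      · rintro rfl
        exact ⟨h1.1, by omega, h1.2⟩
    · exact ⟨Finset.mem_erase.2 hk, fun y hy => hmax y (Finset.mem_erase.1 hy)⟩
    · intro a ha b hb hab hy
      rw [Finset.mem_erase] at ha hb
      refine hT a ha.2 b hb.2 hab fun y hyT hc => ?_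
      have := hTn b hb.2
      exact hy y (Finset.mem_erase.2 ⟨by omega, hyT⟩) hc
    · refine hT k hk.2 n h2.2 (by omega) fun y hyT hc => ?_
      have := hmax y ⟨by omega, hyT⟩
      omega
  · rintro ⟨k, hk1, hkn, ⟨S, T, ⟨hU, hI, ⟨hnS, hSn⟩, hkT, hTk⟩, hS, hT⟩, hd⟩
    refine ⟨S, insert n T, ⟨?_, ?_⟩, hS, ?_⟩
    · intro a
      rw [← hU a, Finset.mem_insert]
      by_cases h : a = n
      · subst h; simp [hnS]
      · simp [h]
    · intro a
      have := hI a
      rw [Finset.mem_insert]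
      by_cases h : a = n
      · subst h; simp [hnS]
      · simp [h, this]
    · intro a ha b hb hab hy
      rw [Finset.mem_insert] at ha hb
      rcases ha with rfl | ha
      · rcases hb with rfl | hb
        · omega
        · have := hTk b hb
          omega
      · rcases hb with rfl | hb
        · have h1 := hTk a ha
          have h2 := hy k (Finset.mem_insert_of_mem hkT)
          have h3 : a = k := by omega
          rw [h3]; exact hd
        · exact hT a ha b hb hab fun y hyT => hy y (Finset.mem_insert_of_mem hyT)
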